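/- Fix 1 ≤ p < ∞ and W ∈ 𝕎, and write 1_n for the indicator function of (n-1, n]. For every ε > 0 there exist natural numbers 1 = k_1 < k_2 < k_3 < ⋯ such that, setting x'_i = ∑_{n=k_i}^{k_{i+1}-1} 1_n and x_i = x'_i / ρ_G(x'_i), the normalized constant-coefficient block sequence (x_i)_{i=1}^∞ is (1+ε)-equivalent to the unit vector basis of ℓ_p: for every finitely supported real sequence (a_i)_{i=1}^∞, (1+ε)^{-1} (∑_i |a_i|^p)^{1/p} ≤ ρ_G(|∑_i a_i x_i|) ≤ (∑_i |a_i|^p)^{1/p}. -/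

import Mathlib

open MeasureTheory Set ENNReal Filter

/-- An MO-isomorphism between subsets `E, F` of `ℝ`: a strictly increasing bijection from `E`
onto `F` such that both it and its inverse are measure-preserving for Lebesgue measure. -/
structure MOIso (E F : Set ℝ) (m : ℝ → ℝ) : Prop where
  bijOn : Set.BijOn m E F
  strictMonoOn : StrictMonoOn m E
  measPres : ∀ A : Set ℝ, A ⊆ F → NullMeasurableSet A volume →
    NullMeasurableSet (E ∩ m ⁻¹' A) volume ∧ volume (E ∩ m ⁻¹' A) = volume A
  invMeasPres : ∀ B : Set ℝ, B ⊆ E → NullMeasurableSet B volume →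
    NullMeasurableSet (m '' B) volume ∧ volume (m '' B) = volume B

/-- The class `𝕎` of weights: nonincreasing Lebesgue-measurable `W : (0,∞) → (0,∞)` with
`W(t) → 0` as `t → ∞`, `∫_0^∞ W = ∞` and `∫_0^1 W < ∞`. -/
def memW (W : ℝ → ℝ) : Prop :=
  AntitoneOn W (Ioi 0) ∧ (∀ t ∈ Ioi (0:ℝ), 0 < W t) ∧ AEMeasurable W volume ∧
    Tendsto W atTop (nhds 0) ∧
    (∫⁻ t in Ioi (0:ℝ), ENNReal.ofReal (W t)) = ∞ ∧
    (∫⁻ t in Ioc (0:ℝ) 1, ENNReal.ofReal (W t)) < ∞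

/-- The Garling function norm
`ρ_G(f) = sup over E, F ⊆ (0,∞) and MO-isomorphisms m : E → F of (∫_E f(m t)^p W(t) dt)^{1/p}`. -/
noncomputable def rhoG (p : ℝ) (W : ℝ → ℝ) (f : ℝ → ℝ≥0∞) : ℝ≥0∞ :=
  ⨆ (E : Set ℝ) (F : Set ℝ) (m : ℝ → ℝ) (_ : E ⊆ Ioi 0) (_ : F ⊆ Ioi 0)
    (_ : NullMeasurableSet E volume) (_ : NullMeasurableSet F volume) (_ : MOIso E F m),
    (∫⁻ t in E, f (m t) ^ p * ENNReal.ofReal (W t)) ^ (1 / p)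


theorem MOIso.nullMeasurableSet_and_volume_le {E F : Set ℝ} {m : ℝ → ℝ} (h : MOIso E F m)
    (hF : NullMeasurableSet F volume) {B : Set ℝ} (hB : MeasurableSet B) :
    NullMeasurableSet (E ∩ m ⁻¹' B) volume ∧ volume (E ∩ m ⁻¹' B) ≤ volume B := by
  have hE : E ∩ m ⁻¹' B = E ∩ m ⁻¹' (F ∩ B) := by
    ext t
    exact ⟨fun ht => ⟨ht.1, h.bijOn.mapsTo ht.1, ht.2⟩, fun ht => ⟨ht.1, ht.2.2⟩⟩
  obtain ⟨h1, h2⟩ := h.measPres (F ∩ B) inter_subset_left (hF.inter hB.nullMeasurableSet)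
  rw [hE]
  exact ⟨h1, h2.trans_le (measure_mono inter_subset_right)⟩

theorem MOIso.add_right {E F : Set ℝ} {k : ℝ} (h : BijOn (· + k) E F) :
    MOIso E F (· + k) where
  bijOn := h
  strictMonoOn := fun _ _ _ _ hxy => by simpa using hxy
  measPres := fun A hA hm => by
    have hEA : E ∩ (· + k) ⁻¹' A = (· + k) ⁻¹' A := by
      refine inter_eq_right.2 fun t ht => ?_
      obtain ⟨s, hs, hst⟩ := h.surjOn (hA ht)
      rwa [← add_right_cancel hst]
    rw [hEA]
    exact ⟨hm.preimage (measurePreserving_add_right volume k).quasiMeasurePreserving,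
      measure_preimage_add_right _ _ _⟩
  invMeasPres := fun B _ hm => by
    rw [image_add_right]
    exact ⟨hm.preimage (measurePreserving_add_right volume (-k)).quasiMeasurePreserving,
      measure_preimage_add_right _ _ _⟩

theorem le_rhoG {p : ℝ} {W : ℝ → ℝ} {f : ℝ → ℝ≥0∞} {E F : Set ℝ} {m : ℝ → ℝ}
    (hE : E ⊆ Ioi 0) (hF : F ⊆ Ioi 0) (hEm : NullMeasurableSet E volume)
    (hFm : NullMeasurableSet F volume) (hm : MOIso E F m) :
    (∫⁻ t in E, f (m t) ^ p * ENNReal.ofReal (W t)) ^ (1 / p) ≤ rhoG p W f :=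
  le_iSup_of_le E <| le_iSup_of_le F <| le_iSup_of_le m <| le_iSup_of_le hE <|
    le_iSup_of_le hF <| le_iSup_of_le hEm <| le_iSup_of_le hFm <| le_iSup_of_le hm le_rfl

theorem rhoG_le {p : ℝ} {W : ℝ → ℝ} {f : ℝ → ℝ≥0∞} {M : ℝ≥0∞} (hp : 0 < p)
    (h : ∀ (E F : Set ℝ) (m : ℝ → ℝ), E ⊆ Ioi 0 → NullMeasurableSet E volume →
      NullMeasurableSet F volume → MOIso E F m →
      ∫⁻ t in E, f (m t) ^ p * ENNReal.ofReal (W t) ≤ M) :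
    rhoG p W f ≤ M ^ (1 / p) := by
  refine iSup_le fun E => iSup_le fun F => iSup_le fun m => iSup_le fun hE => iSup_le fun _ =>
    iSup_le fun hEm => iSup_le fun hFm => iSup_le fun hm => ?_
  exact ENNReal.rpow_le_rpow (h E F m hE hEm hFm hm) (by positivity)

/-- Among subsets of `(0, ∞)` of measure at most `L`, the integral of a nonincreasing function is
largest on `(0, L]`. -/
theorem AntitoneOn.setLIntegral_le_Ioc {w : ℝ → ℝ≥0∞} (hw : AntitoneOn w (Ioi 0)) {L : ℝ}
    (hL : 0 < L) {S : Set ℝ} (hS : S ⊆ Ioi 0) (hSm : NullMeasurableSet S volume)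
    (hvol : volume S ≤ ENNReal.ofReal L) :
    ∫⁻ t in S, w t ≤ ∫⁻ t in Ioc 0 L, w t := by
  have hI : volume (Ioc (0 : ℝ) L) = ENNReal.ofReal L := by simp
  have hdiff : volume (S \ Ioc 0 L) ≤ volume (Ioc 0 L \ S) := by
    have h1 := measure_inter_add_sdiff (μ := volume) S (measurableSet_Ioc (a := (0 : ℝ)) (b := L))
    have h2 := measure_inter_add_sdiff₀ (μ := volume) (Ioc 0 L) hSm
    have hfin : volume (S ∩ Ioc 0 L) ≠ ∞ :=
      ((measure_mono inter_subset_right).trans_lt (hI ▸ ENNReal.ofReal_lt_top)).ne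
    rw [← ENNReal.add_le_add_iff_left hfin, h1, inter_comm, h2, hI]
    exact hvol
  have hout : ∫⁻ t in S \ Ioc 0 L, w t ≤ w L * volume (S \ Ioc 0 L) := by
    rw [← setLIntegral_const]
    refine lintegral_mono_ae ((ae_restrict_iff'₀
      (hSm.diff measurableSet_Ioc.nullMeasurableSet)).2 (ae_of_all _ fun t ht => ?_))
    refine hw hL (hS ht.1) ?_
    by_contra! h
    exact ht.2 ⟨hS ht.1, h.le⟩
  have hin : w L * volume (Ioc 0 L \ S) ≤ ∫⁻ t in Ioc 0 L \ S, w t := by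
    rw [← setLIntegral_const]
    exact lintegral_mono_ae ((ae_restrict_iff'₀
      (measurableSet_Ioc.nullMeasurableSet.diff hSm)).2
        (ae_of_all _ fun t ht => hw ht.1.1 hL ht.1.2))
  calc ∫⁻ t in S, w t
      = (∫⁻ t in S ∩ Ioc 0 L, w t) + ∫⁻ t in S \ Ioc 0 L, w t :=
        (lintegral_inter_add_sdiff _ _ measurableSet_Ioc).symm
    _ ≤ (∫⁻ t in Ioc 0 L ∩ S, w t) + ∫⁻ t in Ioc 0 L \ S, w t := by
        rw [inter_comm]
        refine add_le_add le_rfl ?_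
        exact hout.trans ((by gcongr : _ ≤ w L * volume (Ioc 0 L \ S)).trans hin)
    _ = ∫⁻ t in Ioc 0 L, w t := by
        rw [← lintegral_add_measure, Measure.restrict_inter_add_sdiff₀ _ hSm]

theorem memW.antitoneOn_ofReal {W : ℝ → ℝ} (hW : memW W) :
    AntitoneOn (fun t => ENNReal.ofReal (W t)) (Ioi 0) :=
  fun _ hs _ ht hst => ENNReal.ofReal_le_ofReal (hW.1 hs ht hst)

theorem memW.lintegral_Ioc_ne_top {W : ℝ → ℝ} (hW : memW W) (n : ℝ) :
    ∫⁻ t in Ioc 0 n, ENNReal.ofReal (W t) ≠ ∞ := by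
  have hsub : Ioc 0 n ⊆ Ioc 0 1 ∪ Ioc 1 n := Ioc_subset_Ioc_union_Ioc
  refine ((lintegral_mono_set hsub).trans (lintegral_union_le _ _ _)).trans_lt ?_ |>.ne
  refine ENNReal.add_lt_top.2 ⟨hW.2.2.2.2.2, ?_⟩
  have h : ∫⁻ t in Ioc 1 n, ENNReal.ofReal (W t) ≤ ∫⁻ _ in Ioc 1 n, ENNReal.ofReal (W 1) :=
    setLIntegral_mono' measurableSet_Ioc fun t ht =>
      hW.antitoneOn_ofReal (mem_Ioi.2 one_pos) (mem_Ioi.2 (one_pos.trans ht.1)) ht.1.le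
  refine h.trans_lt ?_
  rw [setLIntegral_const, Real.volume_Ioc]
  exact ENNReal.mul_lt_top ENNReal.ofReal_lt_top ENNReal.ofReal_lt_top

theorem memW.iSup_lintegral_Ioc {W : ℝ → ℝ} (hW : memW W) :
    ⨆ n : ℕ, ∫⁻ t in Ioc (0 : ℝ) n, ENNReal.ofReal (W t) = ∞ := by
  have hU : ⋃ n : ℕ, Ioc (0 : ℝ) n = Ioi 0 := by
    ext x
    simpa using fun _ => exists_nat_ge x
  have hdir : Directed (· ⊆ ·) fun n : ℕ => Ioc (0 : ℝ) n :=
    directed_of_isDirected_le fun i j hij => Ioc_subset_Ioc_right (by exact_mod_cast hij)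
  rw [← setLIntegral_iUnion_of_directed _ hdir, hU]
  exact hW.2.2.2.2.1

theorem memW.lintegral_Ioc_pos {W : ℝ → ℝ} (hW : memW W) {L : ℝ} (hL : 0 < L) :
    0 < ∫⁻ t in Ioc 0 L, ENNReal.ofReal (W t) := by
  have h : ∫⁻ _ in Ioc 0 L, ENNReal.ofReal (W L) ≤ ∫⁻ t in Ioc 0 L, ENNReal.ofReal (W t) :=
    setLIntegral_mono_ae' measurableSet_Ioc
      (ae_of_all _ fun t ht => hW.antitoneOn_ofReal ht.1 hL ht.2)
  refine lt_of_lt_of_le ?_ h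
  rw [setLIntegral_const, Real.volume_Ioc, sub_zero]
  exact ENNReal.mul_pos (ENNReal.ofReal_pos.2 (hW.2.1 L hL)).ne' (ENNReal.ofReal_pos.2 hL).ne'

theorem memW.exists_block {W : ℝ → ℝ} (hW : memW W) {q : ℝ≥0∞} (hq : q < 1) (k : ℕ) :
    ∃ l : ℕ, k < l ∧ q * ∫⁻ t in Ioc (0 : ℝ) (l - k), ENNReal.ofReal (W t) ≤
      ∫⁻ t in Ioc (k : ℝ) l, ENNReal.ofReal (W t) := by
  set Φ : ℝ → ℝ≥0∞ := fun x => ∫⁻ t in Ioc (0 : ℝ) x, ENNReal.ofReal (W t) with hΦ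
  have hmono : Monotone Φ := fun x y hxy => lintegral_mono_set (Ioc_subset_Ioc_right hxy)
  have hr0 : 1 - q ≠ 0 := (tsub_pos_of_lt hq).ne'
  have hr1 : 1 - q ≠ ∞ := (tsub_le_self.trans_lt one_lt_top).ne
  have hlt : Φ k / (1 - q) < ⨆ n : ℕ, Φ n := by
    rw [hΦ, hW.iSup_lintegral_Ioc]
    exact ENNReal.div_lt_top (hW.lintegral_Ioc_ne_top _) hr0
  obtain ⟨l, hl⟩ := lt_iSup_iff.1 hlt
  have hkl : k < l := by
    by_contra! h
    have h1 : Φ l ≤ Φ k := hmono (by exact_mod_cast h)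
    have h2 : Φ k ≤ Φ k / (1 - q) := by
      rw [ENNReal.le_div_iff_mul_le (Or.inl hr0) (Or.inl hr1)]
      exact mul_le_of_le_one_right' tsub_le_self
    exact absurd hl (not_lt.2 (h1.trans h2))
  refine ⟨l, hkl, ?_⟩
  have hΦl : Φ l = Φ k + ∫⁻ t in Ioc (k : ℝ) l, ENNReal.ofReal (W t) := by
    rw [hΦ, ← lintegral_union measurableSet_Ioc (Ioc_disjoint_Ioc_of_le le_rfl),
      Ioc_union_Ioc_eq_Ioc (by positivity) (by exact_mod_cast hkl.le)]
  have hle : Φ k ≤ Φ l * (1 - q) :=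
    (ENNReal.div_le_iff_le_mul (Or.inl hr0) (Or.inl hr1)).1 hl.le
  have hfin : Φ k ≠ ∞ := hW.lintegral_Ioc_ne_top _
  have hmid : q * Φ l ≤ ∫⁻ t in Ioc (k : ℝ) l, ENNReal.ofReal (W t) := by
    rw [← ENNReal.add_le_add_iff_left hfin, ← hΦl]
    calc Φ k + q * Φ l ≤ Φ l * (1 - q) + Φ l * q := by
          rw [mul_comm q]; gcongr
      _ = Φ l := by rw [← mul_add, tsub_add_cancel_of_le hq.le, mul_one]
  refine le_trans ?_ hmid
  gcongr
  exact hmono (by simp)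

theorem memW.lintegral_block_le {W : ℝ → ℝ} (hW : memW W) {k l : ℝ} (hkl : k < l) {E F : Set ℝ}
    {m : ℝ → ℝ} (hE : E ⊆ Ioi 0) (hF : NullMeasurableSet F volume) (hm : MOIso E F m) :
    ∫⁻ t in E ∩ m ⁻¹' Ioc k l, ENNReal.ofReal (W t) ≤
      ∫⁻ t in Ioc (0 : ℝ) (l - k), ENNReal.ofReal (W t) := by
  obtain ⟨h1, h2⟩ := hm.nullMeasurableSet_and_volume_le hF (measurableSet_Ioc (a := k) (b := l))
  exact hW.antitoneOn_ofReal.setLIntegral_le_Ioc (sub_pos.2 hkl) (inter_subset_left.trans hE) h1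
    (h2.trans_eq Real.volume_Ioc)

theorem MOIso.lintegral_indicator_mul {E F : Set ℝ} {m : ℝ → ℝ} (hm : MOIso E F m)
    (hE : NullMeasurableSet E volume) (hF : NullMeasurableSet F volume) {B : Set ℝ}
    (hB : MeasurableSet B) (w : ℝ → ℝ≥0∞) :
    ∫⁻ t in E, B.indicator (fun _ => 1) (m t) * w t = ∫⁻ t in E ∩ m ⁻¹' B, w t := by
  have hS := (hm.nullMeasurableSet_and_volume_le hF hB).1
  rw [← lintegral_indicator₀ hE, ← lintegral_indicator₀ hS]
  congr 1 with t
  by_cases h1 : t ∈ E <;> by_cases h2 : m t ∈ B <;> simp [h1, h2]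

theorem rhoG_indicator_Ioc {p : ℝ} (hp : 0 < p) {W : ℝ → ℝ} (hW : memW W) {k l : ℝ} (hk : 0 ≤ k)
    (hkl : k < l) :
    rhoG p W (fun t => (Ioc k l).indicator (fun _ => (1 : ℝ≥0∞)) t) =
      (∫⁻ t in Ioc (0 : ℝ) (l - k), ENNReal.ofReal (W t)) ^ (1 / p) := by
  have hpow : ∀ s, (Ioc k l).indicator (fun _ => (1 : ℝ≥0∞)) s ^ p =
      (Ioc k l).indicator (fun _ => (1 : ℝ≥0∞)) s := fun s => by
    by_cases h : s ∈ Ioc k l <;> simp [h, hp]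
  apply le_antisymm
  · refine rhoG_le hp fun E F m hE hEm hFm hm => ?_
    simp_rw [hpow]
    rw [hm.lintegral_indicator_mul hEm hFm measurableSet_Ioc]
    exact hW.lintegral_block_le hkl hE hFm hm
  · have hb : BijOn (· + k) (Ioc 0 (l - k)) (Ioc k l) := by
      refine ⟨fun t ht => ?_, (add_left_injective k).injOn, fun t ht => ⟨t - k, ?_, by simp⟩⟩
      · exact ⟨by simpa using ht.1, by simpa [le_sub_iff_add_le] using ht.2⟩
      · exact ⟨sub_pos.2 ht.1, sub_le_sub_right ht.2 k⟩
    have hm := MOIso.add_right hb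
    refine le_trans (le_of_eq ?_) (le_rhoG Ioc_subset_Ioi_self
      (fun t ht => hk.trans_lt ht.1) measurableSet_Ioc.nullMeasurableSet
      measurableSet_Ioc.nullMeasurableSet hm)
    simp_rw [hpow]
    rw [hm.lintegral_indicator_mul measurableSet_Ioc.nullMeasurableSet
      measurableSet_Ioc.nullMeasurableSet measurableSet_Ioc,
      inter_eq_left.2 (show Ioc 0 (l - k) ⊆ (· + k) ⁻¹' Ioc k l from hb.mapsTo)]

theorem ofReal_abs_tsum_indicator_rpow {p : ℝ} (hp : 0 < p) {B : ℕ → Set ℝ}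
    (hB : Pairwise (Function.onFun Disjoint B)) {c : ℕ → ℝ} (hc : ∀ i, 0 < c i) (a : ℕ → ℝ)
    (s : ℝ) :
    ENNReal.ofReal |∑' i, (a i / c i) * (B i).indicator (fun _ => (1 : ℝ)) s| ^ p =
      ∑' i, ENNReal.ofReal |a i| ^ p / ENNReal.ofReal (c i) ^ p *
        (B i).indicator (fun _ => (1 : ℝ≥0∞)) s := by
  by_cases h : ∃ i, s ∈ B i
  · obtain ⟨i, hi⟩ := h
    have hne : ∀ j, j ≠ i → s ∉ B j := fun j hj hs => disjoint_left.1 (hB hj) hs hi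
    rw [tsum_eq_single i fun j hj => by simp [hne j hj],
      tsum_eq_single i fun j hj => by simp [hne j hj]]
    simp only [hi, indicator_of_mem, mul_one]
    rw [abs_div, abs_of_pos (hc i), ENNReal.ofReal_div_of_pos (hc i),
      ENNReal.div_rpow_of_nonneg _ _ hp.le]
  · push Not at h
    simp [h, hp]

theorem MOIso.lintegral_blocks {p : ℝ} (hp : 0 < p) {W : ℝ → ℝ} (hW : memW W) {B : ℕ → Set ℝ}
    (hBm : ∀ i, MeasurableSet (B i)) (hB : Pairwise (Function.onFun Disjoint B)) {c : ℕ → ℝ}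
    (hc : ∀ i, 0 < c i) (a : ℕ → ℝ) {E F : Set ℝ} {m : ℝ → ℝ} (hm : MOIso E F m)
    (hE : NullMeasurableSet E volume) (hF : NullMeasurableSet F volume) :
    ∫⁻ t in E, ENNReal.ofReal
        |∑' i, (a i / c i) * (B i).indicator (fun _ => (1 : ℝ)) (m t)| ^ p *
          ENNReal.ofReal (W t) =
      ∑' i, ENNReal.ofReal |a i| ^ p / ENNReal.ofReal (c i) ^ p *
        ∫⁻ t in E ∩ m ⁻¹' B i, ENNReal.ofReal (W t) := by
  have hmeas : ∀ i, AEMeasurable (fun t => (B i).indicator (fun _ => (1 : ℝ≥0∞)) (m t) *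
      ENNReal.ofReal (W t)) (volume.restrict E) := fun i => by
    have hS := (hm.nullMeasurableSet_and_volume_le hF (hBm i)).1
    have hw : AEMeasurable (fun t => ENNReal.ofReal (W t)) (volume.restrict E) :=
      hW.2.2.1.ennreal_ofReal.restrict
    refine (hw.indicator₀ (hS.mono_ac Measure.restrict_le_self.absolutelyContinuous)).congr ?_
    refine (ae_restrict_iff'₀ hE).2 (ae_of_all _ fun t ht => ?_)
    by_cases h : m t ∈ B i <;> simp [ht, h]
  simp_rw [ofReal_abs_tsum_indicator_rpow hp hB hc a, ← ENNReal.tsum_mul_right, mul_assoc]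
  rw [lintegral_tsum fun i => (hmeas i).const_mul _]
  refine tsum_congr fun i => ?_
  rw [lintegral_const_mul'' _ (hmeas i), hm.lintegral_indicator_mul hE hF (hBm i)]

/-- For `1 ≤ p < ∞`, `W ∈ 𝕎` and every `ε > 0`, there are
`0 = k_0 < k_1 < k_2 < ⋯` such that the normalized constant-coefficient blocks
`x_i = (∑_{n=k_i}^{k_{i+1}-1} 1_n) / ρ_G(∑_{n=k_i}^{k_{i+1}-1} 1_n)`
(so `x'_i` is the indicator of `(k_i, k_{i+1}]`) form a sequence `(1+ε)`-equivalent to the unit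
vector basis of `ℓ_p`. -/
theorem stmt14 (p : ℝ) (hp : 1 ≤ p) (W : ℝ → ℝ) (hW : memW W) (ε : ℝ) (hε : 0 < ε) :
    ∃ k : ℕ → ℕ, k 0 = 0 ∧ StrictMono k ∧
      ∃ c : ℕ → ℝ,
        (∀ i, 0 < c i ∧ ENNReal.ofReal (c i) =
          rhoG p W (fun t =>
            (Ioc (k i : ℝ) (k (i + 1) : ℝ)).indicator (fun _ => (1 : ℝ≥0∞)) t)) ∧
        ∀ a : ℕ → ℝ, (Function.support a).Finite →
          ENNReal.ofReal (1 + ε)⁻¹ * (∑' i : ℕ, ENNReal.ofReal |a i| ^ p) ^ (1 / p) ≤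
            rhoG p W (fun t => ENNReal.ofReal
              |∑' i : ℕ, (a i / c i) *
                (Ioc (k i : ℝ) (k (i + 1) : ℝ)).indicator (fun _ => (1 : ℝ)) t|) ∧
          rhoG p W (fun t => ENNReal.ofReal
              |∑' i : ℕ, (a i / c i) *
                (Ioc (k i : ℝ) (k (i + 1) : ℝ)).indicator (fun _ => (1 : ℝ)) t|) ≤
            (∑' i : ℕ, ENNReal.ofReal |a i| ^ p) ^ (1 / p) := by
  have hp0 : 0 < p := one_pos.trans_le hp
  have hpi : 0 < 1 / p := by positivity
  have hε1 : (1 + ε)⁻¹ < 1 := inv_lt_one_of_one_lt₀ (by linarith)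
  set q : ℝ≥0∞ := ENNReal.ofReal (1 + ε)⁻¹ ^ p with hq
  have hq1 : q < 1 := ENNReal.rpow_lt_one (by simpa using hε1) hp0
  choose g hg hgint using fun k => hW.exists_block hq1 k
  let k : ℕ → ℕ := fun n => g^[n] 0
  have hks : ∀ i, k (i + 1) = g (k i) := fun i => Function.iterate_succ_apply' g i 0
  have hkmono : StrictMono k := strictMono_nat_of_lt_succ fun i => by rw [hks]; exact hg _
  have hlt : ∀ i, (k i : ℝ) < k (i + 1) := fun i => by exact_mod_cast hkmono i.lt_succ_self
  set C : ℕ → ℝ≥0∞ := fun i =>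
    ∫⁻ t in Ioc (0 : ℝ) ((k (i + 1) : ℝ) - k i), ENNReal.ofReal (W t) with hC
  have hC0 : ∀ i, 0 < C i := fun i => hW.lintegral_Ioc_pos (sub_pos.2 (hlt i))
  have hCtop : ∀ i, C i ≠ ∞ := fun i => hW.lintegral_Ioc_ne_top _
  have hCr : ∀ i, C i ^ (1 / p) ≠ ∞ := fun i => ENNReal.rpow_ne_top_of_nonneg hpi.le (hCtop i)
  have hc : ∀ i, 0 < (C i ^ (1 / p)).toReal := fun i =>
    ENNReal.toReal_pos (ENNReal.rpow_pos (hC0 i) (hCtop i)).ne' (hCr i)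
  have hcp : ∀ i, ENNReal.ofReal (C i ^ (1 / p)).toReal ^ p = C i := fun i => by
    rw [ENNReal.ofReal_toReal (hCr i), ← ENNReal.rpow_mul, one_div_mul_cancel hp0.ne',
      ENNReal.rpow_one]
  have hdisj : Pairwise (Function.onFun Disjoint fun i => Ioc (k i : ℝ) (k (i + 1) : ℝ)) :=
    (Nat.mono_cast.comp hkmono.monotone).pairwise_disjoint_on_Ioc_succ
  refine ⟨k, rfl, hkmono, fun i => (C i ^ (1 / p)).toReal, fun i => ⟨hc i, ?_⟩, fun a _ => ⟨?_, ?_⟩⟩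
  · rw [ENNReal.ofReal_toReal (hCr i)]
    exact (rhoG_indicator_Ioc hp0 hW (Nat.cast_nonneg _) (hlt i)).symm
  · have hm : MOIso (Ioi 0) (Ioi 0) (· + (0 : ℝ)) :=
      MOIso.add_right (by simpa only [add_zero] using! bijOn_id (Ioi (0 : ℝ)))
    refine le_trans ?_ (le_rhoG Subset.rfl Subset.rfl measurableSet_Ioi.nullMeasurableSet
      measurableSet_Ioi.nullMeasurableSet hm)
    rw [hm.lintegral_blocks hp0 hW (fun _ => measurableSet_Ioc) hdisj hc a
      measurableSet_Ioi.nullMeasurableSet measurableSet_Ioi.nullMeasurableSet]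
    have hqr : ENNReal.ofReal (1 + ε)⁻¹ = q ^ (1 / p) := by
      rw [hq, ← ENNReal.rpow_mul, mul_one_div_cancel hp0.ne', ENNReal.rpow_one]
    rw [hqr, ← ENNReal.mul_rpow_of_nonneg _ _ hpi.le, ← ENNReal.tsum_mul_left]
    refine ENNReal.rpow_le_rpow (ENNReal.tsum_le_tsum fun i => ?_) hpi.le
    have hset : Ioi (0 : ℝ) ∩ (· + (0 : ℝ)) ⁻¹' Ioc (k i : ℝ) (k (i + 1)) =
        Ioc (k i : ℝ) (k (i + 1)) := by
      simp only [add_zero, preimage_id']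
      exact inter_eq_right.2 fun t ht => (Nat.cast_nonneg (k i)).trans_lt ht.1
    rw [hset, hcp]
    have hblock := hgint (k i)
    rw [← hks] at hblock
    calc q * ENNReal.ofReal |a i| ^ p
        = ENNReal.ofReal |a i| ^ p / C i * (q * C i) := by
          rw [mul_left_comm, ENNReal.div_mul_cancel (hC0 i).ne' (hCtop i)]
      _ ≤ _ := by gcongr
  · refine rhoG_le hp0 fun E F m hE hEm hFm hm => ?_
    rw [hm.lintegral_blocks hp0 hW (fun _ => measurableSet_Ioc) hdisj hc a hEm hFm]
    refine ENNReal.tsum_le_tsum fun i => ?_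
    rw [hcp]
    calc _ ≤ ENNReal.ofReal |a i| ^ p / C i * C i := by
          gcongr
          exact hW.lintegral_block_le (hlt i) hE hFm hm
      _ = ENNReal.ofReal |a i| ^ p := ENNReal.div_mul_cancel (hC0 i).ne' (hCtop i)
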